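/- arXiv:1903.05655 — 3 statements merged into one kernel-verified Lean document; each statement's English description precedes it below -/
import Mathlib

section
/- Let l ≥ 1 and let r_1,…,r_l be non-negative integers. There exist non-negative integers p_1,…,p_l, q_1,…,q_l with p_1 = 0, q_l = 0, q_i·p_{i+1} = 0 for all 1 ≤ i ≤ l−1, p_i ≡ q_i (mod 2) for all i, and p_i + q_i = 2r_i for every i, if and only if r_i = 0 for some i ∈ {1,…,l}. -/
/-- Let `l ≥ 1` and let `r₁,…,r_l` be non-negative integers.  There exist non-negative
integers `p₁,…,p_l, q₁,…,q_l` with `p₁ = 0`, `q_l = 0`, `q_i · p_{i+1} = 0` for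
`1 ≤ i ≤ l−1`, `p_i ≡ q_i (mod 2)` for all `i`, and `p_i + q_i = 2 r_i` for every `i`,
if and only if `r_i = 0` for some `i ∈ {1,…,l}`. -/
theorem generating_algebra_summand_nonzero_iff (l : ℕ) (hl : 1 ≤ l) (r : ℕ → ℕ) :
    (∃ p q : ℕ → ℕ,
      p 1 = 0 ∧ q l = 0 ∧
      (∀ i, 1 ≤ i → i ≤ l - 1 → q i * p (i + 1) = 0) ∧
      (∀ i, 1 ≤ i → i ≤ l → p i % 2 = q i % 2) ∧
      (∀ i, 1 ≤ i → i ≤ l → p i + q i = 2 * r i)) ↔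
    ∃ i, 1 ≤ i ∧ i ≤ l ∧ r i = 0 := by
  constructor
  · rintro ⟨p, q, hp, hq, hqp, -, hsum⟩
    by_contra! hr
    have hp_zero : ∀ i, 1 ≤ i → i ≤ l → p i = 0 := by
      intro i hi
      induction i, hi using Nat.le_induction with
      | base => exact fun _ => hp
      | succ i hi ih =>
        intro hil
        have hsum_i := hsum i hi (by omega)
        have hr_i := hr i hi (by omega)
        have hp_i := ih (by omega)
        exact (Nat.mul_eq_zero.mp (hqp i hi (by omega))).resolve_left (by omega)
    have hsum_l := hsum l hl le_rfl
    have hr_l := hr l hl le_rfl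
    have hp_l := hp_zero l hl le_rfl
    omega
  · rintro ⟨k, hk, hkl, hrk⟩
    refine ⟨fun i => if i ≤ k then 0 else 2 * r i, fun i => if i < k then 2 * r i else 0,
      if_pos hk, if_neg (by omega), fun i _ _ => ?_, fun i _ _ => ?_, fun i _ _ => ?_⟩
    · rcases lt_or_ge i k with h | h
      · simp [Nat.succ_le_of_lt h]
      · simp [h.not_gt]
    · dsimp only
      split_ifs <;> omega
    · rcases lt_trichotomy i k with h | rfl | h
      · simp [h, h.le]
      · simp [hrk]
      · simp [h.not_ge, h.not_gt]
end

section
/- Fix a non-negative integer r. Let C be the chain complex of F_2-vector spaces in which, for each integer s, C_s has basis the set of pairs (p,q) of non-negative integers with p + q = 2r and |p − q| = 2(s + r) (so C_s = 0 unless −r ≤ s ≤ 0), and the differential ∂ : C_s → C_{s−1} is given on basis elements by: ∂(p,q) = 0 if p = q; ∂(p,q) = (r,r) if |p − q| = 2; and ∂(p,q) = (min(p,q)+1, max(p,q)−1) + (max(p,q)−1, min(p,q)+1) if |p − q| ≥ 4. Then ∂ ∘ ∂ = 0, the homology H_s(C) vanishes for all s ≠ 0, and H_0(C) is 1-dimensional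 over F_2, generated by the class of (2r,0) + (0,2r) when r > 0 and by the class of (0,0) when r = 0. -/
namespace StrandsEdgeComplex

/-- The basis of `C_s`: pairs `(p,q)` of non-negative integers with `p + q = 2r` and
`|p − q| = 2(s + r)`. -/
def basisSet (r : ℕ) (s : ℤ) : Set (ℕ × ℕ) :=
  {pq | pq.1 + pq.2 = 2 * r ∧ ((((pq.1 : ℤ) - (pq.2 : ℤ)).natAbs : ℤ)) = 2 * (s + (r : ℤ))}

/-- `C_s`, the span over `F₂` of the basis pairs, realized as the submodule of finitely
supported functions `(ℕ × ℕ) →₀ F₂` supported on `basisSet r s`. -/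
noncomputable def C (r : ℕ) (s : ℤ) : Submodule (ZMod 2) ((ℕ × ℕ) →₀ ZMod 2) :=
  Finsupp.supported (ZMod 2) (ZMod 2) (basisSet r s)

/-- The value of the differential on the basis element `(p,q)`:
`0` if `p = q`; `(r,r)` if `|p − q| = 2`; and
`(min+1, max−1) + (max−1, min+1)` if `|p − q| ≥ 4`. -/
noncomputable def dElt (r : ℕ) (pq : ℕ × ℕ) : (ℕ × ℕ) →₀ ZMod 2 :=
  if pq.1 = pq.2 then 0
  else if ((pq.1 : ℤ) - (pq.2 : ℤ)).natAbs = 2 then Finsupp.single (r, r) 1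
  else
    Finsupp.single (min pq.1 pq.2 + 1, max pq.1 pq.2 - 1) 1 +
      Finsupp.single (max pq.1 pq.2 - 1, min pq.1 pq.2 + 1) 1

/-- The differential, extended linearly. -/
noncomputable def D (r : ℕ) : ((ℕ × ℕ) →₀ ZMod 2) →ₗ[ZMod 2] ((ℕ × ℕ) →₀ ZMod 2) :=
  Finsupp.lift ((ℕ × ℕ) →₀ ZMod 2) (ZMod 2) (ℕ × ℕ) (dElt r)

/-- The generator of `H₀`: `(2r,0) + (0,2r)` if `r > 0`, and `(0,0)` if `r = 0`. -/
noncomputable def gen (r : ℕ) : (ℕ × ℕ) →₀ ZMod 2 :=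
  if r = 0 then Finsupp.single (0, 0) 1
  else Finsupp.single (2 * r, 0) 1 + Finsupp.single (0, 2 * r) 1

/-- The cycle in degree `k - r`, the sum of all basis elements of that degree. -/
noncomputable def cyc (r k : ℕ) : (ℕ × ℕ) →₀ ZMod 2 :=
  if k = 0 then Finsupp.single (r, r) 1
  else Finsupp.single (r + k, r - k) 1 + Finsupp.single (r - k, r + k) 1

theorem cyc_ne_zero (r k : ℕ) : cyc r k ≠ 0 := by
  intro h
  have h' := DFunLike.congr_fun h (r + k, r - k)
  unfold cyc at h'
  split_ifs at h' with hk
  · subst hk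
    simp at h'
  · have hne : ((r - k, r + k) : ℕ × ℕ) ≠ (r + k, r - k) := by
      intro he
      have := (Prod.ext_iff.1 he).2
      simp only at this
      omega
    rw [Finsupp.add_apply, Finsupp.single_eq_same, Finsupp.single_eq_of_ne hne.symm] at h'
    simp at h'

theorem mem_basisSet_iff {r k : ℕ} (hk : k ≤ r) (pq : ℕ × ℕ) :
    pq ∈ basisSet r ((k : ℤ) - r) ↔ pq = (r + k, r - k) ∨ pq = (r - k, r + k) := by
  obtain ⟨p, q⟩ := pq
  simp only [basisSet, Set.mem_ofPred_eq, Prod.mk.injEq]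
  omega

theorem eq_sub_of_mem_basisSet {r : ℕ} {s : ℤ} {pq : ℕ × ℕ} (h : pq ∈ basisSet r s) :
    ∃ k ≤ r, s = (k : ℤ) - r := by
  simp only [basisSet, Set.mem_ofPred_eq] at h
  exact ⟨(s + r).toNat, by omega, by omega⟩

theorem single_mem_C {r k : ℕ} (hk : k ≤ r) (x : ZMod 2) :
    Finsupp.single (r + k, r - k) x ∈ C r ((k : ℤ) - r) :=
  Finsupp.single_mem_supported _ _ ((mem_basisSet_iff hk _).2 (Or.inl rfl))

theorem single_mem_C' {r k : ℕ} (hk : k ≤ r) (x : ZMod 2) :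
    Finsupp.single (r - k, r + k) x ∈ C r ((k : ℤ) - r) :=
  Finsupp.single_mem_supported _ _ ((mem_basisSet_iff hk _).2 (Or.inr rfl))

theorem cyc_mem_C {r k : ℕ} (hk : k ≤ r) : cyc r k ∈ C r ((k : ℤ) - r) := by
  unfold cyc
  split_ifs with h
  · subst h
    exact single_mem_C hk 1
  · exact add_mem (single_mem_C hk 1) (single_mem_C' hk 1)

theorem eq_zero_or_exists_of_mem_C {r : ℕ} {s : ℤ} {f : (ℕ × ℕ) →₀ ZMod 2} (hf : f ∈ C r s) :
    f = 0 ∨ ∃ k ≤ r, s = (k : ℤ) - r ∧ ∃ x y : ZMod 2,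
      f = Finsupp.single (r + k, r - k) x + Finsupp.single (r - k, r + k) y := by
  by_cases h : ∃ pq, pq ∈ basisSet r s
  · obtain ⟨pq, hpq⟩ := h
    obtain ⟨k, hk, rfl⟩ := eq_sub_of_mem_basisSet hpq
    refine Or.inr ⟨k, hk, rfl, ?_⟩
    have hs : basisSet r ((k : ℤ) - r) = {(r + k, r - k), (r - k, r + k)} :=
      Set.ext fun pq => mem_basisSet_iff hk pq
    rw [C, hs, Finsupp.supported_eq_span_single, Set.image_pair, Submodule.mem_span_pair] at hf
    obtain ⟨x, y, rfl⟩ := hf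
    exact ⟨x, y, by simp⟩
  · left
    push Not at h
    rw [C, Set.eq_empty_iff_forall_notMem.2 h, Finsupp.supported_empty] at hf
    exact (Submodule.mem_bot _).1 hf

theorem D_single (r : ℕ) (pq : ℕ × ℕ) (x : ZMod 2) :
    D r (Finsupp.single pq x) = x • dElt r pq := by
  simp [D]

theorem dElt_eq_zero (r : ℕ) : dElt r (r, r) = 0 := by
  simp [dElt]

theorem dElt_eq_cyc {r k p q : ℕ} (hk : k + 1 ≤ r) (hmin : min p q = r - (k + 1))
    (hmax : max p q = r + (k + 1)) : dElt r (p, q) = cyc r k := by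
  have h₁ : r - (k + 1) + 1 = r - k := by omega
  have h₂ : r + (k + 1) - 1 = r + k := by omega
  have hiff : ((p : ℤ) - q).natAbs = 2 ↔ k = 0 := by omega
  have hne : p ≠ q := by omega
  simp only [dElt, cyc, hmin, hmax, h₁, h₂, hne, if_false, hiff]
  rw [add_comm (Finsupp.single (r - k, r + k) (1 : ZMod 2))]

theorem D_pair {r k : ℕ} (hk : k + 1 ≤ r) (x y : ZMod 2) :
    D r (Finsupp.single (r + (k + 1), r - (k + 1)) x +
      Finsupp.single (r - (k + 1), r + (k + 1)) y) = (x + y) • cyc r k := by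
  rw [map_add, D_single, D_single, dElt_eq_cyc hk (by omega) (by omega),
    dElt_eq_cyc hk (by omega) (by omega), add_smul]

theorem D_pair_zero (r : ℕ) (x y : ZMod 2) :
    D r (Finsupp.single (r + 0, r - 0) x + Finsupp.single (r - 0, r + 0) y) = 0 := by
  simp [D_single, dElt_eq_zero]

theorem D_cyc {r k : ℕ} (hk : k ≤ r) : D r (cyc r k) = 0 := by
  cases k with
  | zero => simp [cyc, D_single, dElt_eq_zero]
  | succ k =>
    rw [cyc, if_neg k.succ_ne_zero, D_pair hk, CharTwo.add_self_eq_zero, zero_smul]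

theorem exists_D_eq_smul_cyc {r k : ℕ} (hk : k + 1 ≤ r) (c : ZMod 2) :
    ∃ g ∈ C r (((k + 1 : ℕ) : ℤ) - r), D r g = c • cyc r k :=
  ⟨_, single_mem_C hk c, by
    simpa using D_pair hk c 0⟩

/-- Every cycle is a multiple of `cyc r k`. -/
theorem eq_smul_cyc_of_D_eq_zero {r : ℕ} {s : ℤ} {f : (ℕ × ℕ) →₀ ZMod 2} (hf : f ∈ C r s)
    (h : D r f = 0) : f = 0 ∨ ∃ k ≤ r, s = (k : ℤ) - r ∧ ∃ c : ZMod 2, f = c • cyc r k := by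
  obtain rfl | ⟨k, hk, hs, x, y, rfl⟩ := eq_zero_or_exists_of_mem_C hf
  · exact Or.inl rfl
  refine Or.inr ⟨k, hk, hs, ?_⟩
  cases k with
  | zero => exact ⟨x + y, by simp [cyc, Finsupp.single_add]⟩
  | succ k =>
    rw [D_pair hk, smul_eq_zero_iff_left (cyc_ne_zero r k), CharTwo.add_eq_zero] at h
    subst h
    exact ⟨x, by simp [cyc]⟩

theorem gen_eq_cyc (r : ℕ) : gen r = cyc r r := by
  unfold gen cyc
  split_ifs with h
  · rw [h]
  · rw [two_mul, Nat.sub_self]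

/-- The differential maps `C_s` to `C_{s−1}` and squares to zero; the homology `H_s`
vanishes for `s ≠ 0`; and `H₀` is 1-dimensional over `F₂`, generated by the class of
`(2r,0) + (0,2r)` when `r > 0` and of `(0,0)` when `r = 0`. -/
theorem homology_of_edge_algebra_rank_one (r : ℕ) :
    (∀ s : ℤ, ∀ f ∈ C r s, D r f ∈ C r (s - 1)) ∧
    (∀ s : ℤ, ∀ f ∈ C r s, D r (D r f) = 0) ∧
    (∀ s : ℤ, s ≠ 0 → ∀ f ∈ C r s, D r f = 0 → ∃ g ∈ C r (s + 1), D r g = f) ∧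
    gen r ∈ C r 0 ∧ D r (gen r) = 0 ∧
    (∀ g ∈ C r 1, D r g ≠ gen r) ∧
    (∀ f ∈ C r 0, D r f = 0 → ∃ c : ZMod 2, ∃ g ∈ C r 1, f = c • gen r + D r g) := by
  refine ⟨fun s f hf => ?_, fun s f hf => ?_, fun s hs f hf h => ?_, ?_, ?_, fun g hg => ?_,
    fun f hf h => ?_⟩
  · obtain rfl | ⟨k, hk, rfl, x, y, rfl⟩ := eq_zero_or_exists_of_mem_C hf
    · rw [map_zero]
      exact zero_mem _
    cases k with
    | zero =>
      rw [D_pair_zero]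
      exact zero_mem _
    | succ k =>
      rw [D_pair hk, show ((k + 1 : ℕ) : ℤ) - r - 1 = k - r by push_cast; ring]
      exact Submodule.smul_mem _ _ (cyc_mem_C (by omega))
  · obtain rfl | ⟨k, hk, rfl, x, y, rfl⟩ := eq_zero_or_exists_of_mem_C hf
    · rw [map_zero, map_zero]
    cases k with
    | zero => rw [D_pair_zero, map_zero]
    | succ k => rw [D_pair hk, map_smul, D_cyc (by omega), smul_zero]
  · obtain rfl | ⟨k, hk, rfl, c, rfl⟩ := eq_smul_cyc_of_D_eq_zero hf h
    · exact ⟨0, zero_mem _, map_zero _⟩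
    rw [show (k : ℤ) - r + 1 = ((k + 1 : ℕ) : ℤ) - r by push_cast; ring]
    exact exists_D_eq_smul_cyc (by omega) c
  · rw [gen_eq_cyc, ← sub_self (r : ℤ)]
    exact cyc_mem_C le_rfl
  · rw [gen_eq_cyc, D_cyc le_rfl]
  · obtain rfl | ⟨k, hk, hs, -⟩ := eq_zero_or_exists_of_mem_C hg
    · rw [map_zero, gen_eq_cyc]
      exact (cyc_ne_zero r r).symm
    · omega
  · obtain rfl | ⟨k, hk, hs, c, rfl⟩ := eq_smul_cyc_of_D_eq_zero hf h
    · exact ⟨0, 0, zero_mem _, by simp⟩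
    · obtain rfl : k = r := by omega
      exact ⟨c, 0, zero_mem _, by rw [gen_eq_cyc, map_zero, add_zero]⟩

end StrandsEdgeComplex
end

section
/- Let B be a set and M : B → B an involution with no fixed points. Let I ⊆ B be a subset with I ∩ M(I) = ∅, and let j ⊆ I. Set I_j := (I \ j) ∪ M(j). Then the map sending a subset i ⊆ I to (i \ j) ∪ M(j \ i) is a bijection from the set of subsets of I to the set of subsets of I_j, with inverse sending k ⊆ I_j to (k \ M(j)) ∪ (j \ M(k)). -/
theorem Function.Involutive.mem_image_iff {B : Type*} {M : B → B}
    (hM : Function.Involutive M) (S : Set B) (x : B) : x ∈ M '' S ↔ M x ∈ S := by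
  rw [Set.image_eq_preimage_of_inverse hM hM, Set.mem_preimage]

/-- Let `M : B → B` be a fixed-point-free involution, `I ⊆ B` with `I ∩ M(I) = ∅`, and
`j ⊆ I`.  Set `I_j := (I \ j) ∪ M(j)`.  Then `i ↦ (i \ j) ∪ M(j \ i)` is a bijection
from the subsets of `I` to the subsets of `I_j`, with inverse
`k ↦ (k \ M(j)) ∪ (j \ M(k))`. -/
theorem constant_strand_slide_bijection {B : Type*} (M : B → B)
    (hM : Function.Involutive M) (hMfix : ∀ b, M b ≠ b)
    (I : Set B) (hI : I ∩ (M '' I) = ∅) (j : Set B) (hj : j ⊆ I) :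
    Set.BijOn (fun i => (i \ j) ∪ M '' (j \ i))
      {i : Set B | i ⊆ I} {k : Set B | k ⊆ (I \ j) ∪ M '' j} ∧
    (∀ i : Set B, i ⊆ I →
      ((((i \ j) ∪ M '' (j \ i)) \ M '' j) ∪ (j \ M '' ((i \ j) ∪ M '' (j \ i)))) = i) ∧
    (∀ k : Set B, k ⊆ (I \ j) ∪ M '' j →
      ((((k \ M '' j) ∪ (j \ M '' k)) \ j) ∪ M '' (j \ ((k \ M '' j) ∪ (j \ M '' k)))) = k) := by
  have mem_image (S : Set B) (x : B) := hM.mem_image_iff S x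
  have disj (x : B) (hx : x ∈ I) : M x ∉ I := fun h =>
    hI.subset ⟨hx, (mem_image I x).2 h⟩
  have left_inv (i : Set B) (hi : i ⊆ I) :
      ((((i \ j) ∪ M '' (j \ i)) \ M '' j) ∪ (j \ M '' ((i \ j) ∪ M '' (j \ i)))) = i := by
    ext x
    have hxx := hM x
    have := disj x
    have := @hi x
    have := @hj x
    have := @hi (M x)
    have := @hj (M x)
    simp only [Set.mem_union, Set.mem_sdiff, mem_image, hxx]
    tauto
  have right_inv (k : Set B) (hk : k ⊆ (I \ j) ∪ M '' j) :
      ((((k \ M '' j) ∪ (j \ M '' k)) \ j) ∪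
        M '' (j \ ((k \ M '' j) ∪ (j \ M '' k)))) = k := by
    ext x
    have hxx := hM x
    have := disj x
    have := @hj x
    have := @hj (M x)
    have hkx := @hk x
    have hkMx := @hk (M x)
    simp only [Set.mem_union, Set.mem_sdiff, mem_image, hxx] at hkx hkMx ⊢
    tauto
  refine ⟨Set.InvOn.bijOn (f' := fun k => (k \ M '' j) ∪ (j \ M '' k))
    ⟨left_inv, right_inv⟩ ?_ ?_, left_inv, right_inv⟩
  · rintro i hi
    exact Set.union_subset_union (Set.sdiff_subset_sdiff_left hi) (Set.image_mono Set.sdiff_subset)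
  · rintro k hk x (⟨hxk, hxj⟩ | ⟨hxj, -⟩)
    · exact ((hk hxk).resolve_right hxj).1
    · exact hj hxj
end
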